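/- For every integer r with 2 ≤ r ≤ n, P(A_r ∩ (A'_r)ᶜ) ≥ P(A'_r ∩ (A_r)ᶜ); equivalently, P(A_r) ≥ P(A'_r). -/

import Mathlib

open Finset

/-- A configuration: `x : [n] → [k+1]` assigns passengers to `k + 1` buses and
`y : [n] → [k]` gives the auxiliary reassignment choices `Y_1, …, Y_n`. -/
abbrev Config (n k : ℕ) := (Fin n → Fin (k + 1)) × (Fin n → Fin k)

/-- `Xcount n k c i` is the number of passengers initially assigned to bus `i`. -/
def Xcount (n k : ℕ) (c : Config n k) (i : Fin (k + 1)) : ℕ :=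
  (Finset.univ.filter fun p => c.1 p = i).card

/-- `Xcount' n k c i` is the number of passengers on bus `i ∈ [k]` after the
`m = X_{k+1}` passengers on bus `k + 1` are reassigned to buses `Y_1, …, Y_m`. -/
def Xcount' (n k : ℕ) (c : Config n k) (i : Fin k) : ℕ :=
  Xcount n k c i.castSucc +
    (Finset.univ.filter fun j : Fin n =>
      (j : ℕ) < Xcount n k c (Fin.last k) ∧ c.2 j = i).card

open Classical in
/-- The probability of an event under the uniform distribution on
configurations. -/
noncomputable def prob (n k : ℕ) (E : Set (Config n k)) : ℝ :=
  ((Finset.univ.filter fun c => c ∈ E).card : ℝ) / (Fintype.card (Config n k) : ℝ)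

/-- The event `A` that some bus (among all `k + 1`) has exactly one passenger
before reassignment. -/
def eventA (n k : ℕ) : Set (Config n k) := {c | ∃ i : Fin (k + 1), Xcount n k c i = 1}

/-- The event `A'` that some bus among the first `k` has exactly one passenger
after reassignment. -/
def eventA' (n k : ℕ) : Set (Config n k) := {c | ∃ i : Fin k, Xcount' n k c i = 1}

/-- The number of buses `i ∈ [k]` with exactly one passenger (before
reassignment). -/
def onesCount (n k : ℕ) (c : Config n k) : ℕ :=
  (Finset.univ.filter fun i : Fin k => Xcount n k c i.castSucc = 1).card

/-- The event `A_r` that at least `r` of the buses `1, …, k + 1` have exactly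
one passenger before reassignment. -/
def eventAr (n k r : ℕ) : Set (Config n k) :=
  {c | r ≤ (Finset.univ.filter fun i : Fin (k + 1) => Xcount n k c i = 1).card}

/-- The event `A'_r` that at least `r` of the buses `1, …, k` have exactly one
passenger after reassignment. -/
def eventAr' (n k r : ℕ) : Set (Config n k) :=
  {c | r ≤ (Finset.univ.filter fun i : Fin k => Xcount' n k c i = 1).card}

/-- The index set `P = {(m, ℓ) : m ≥ 2, ℓ ≥ 0, 0 < r − ℓ ≤ m}`. -/
def Pidx (r : ℕ) : Set (ℕ × ℕ) := {p | 2 ≤ p.1 ∧ p.2 < r ∧ r - p.2 ≤ p.1}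

/-- The associated Stirling number of the second kind: the number of partitions of an `n`-element
set into `j` blocks, each of size at least two. -/
def assocStirling : ℕ → ℕ → ℕ
  | 0, 0 => 1
  | 0, _ + 1 => 0
  | 1, _ => 0
  | _ + 2, 0 => 0
  | n + 2, j + 1 => (j + 1) * assocStirling (n + 1) (j + 1) + (n + 1) * assocStirling n j

namespace assocStirling

theorem succ_zero (n : ℕ) : assocStirling (n + 1) 0 = 0 := by
  cases n <;> simp [assocStirling]

theorem one_left (j : ℕ) : assocStirling 1 j = 0 := by simp [assocStirling]

theorem add_two_succ (n j : ℕ) : assocStirling (n + 2) (j + 1) =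
    (j + 1) * assocStirling (n + 1) (j + 1) + (n + 1) * assocStirling n j := by
  simp [assocStirling]

theorem eq_zero_of_lt {n j : ℕ} (h : n < 2 * j) : assocStirling n j = 0 := by
  induction n using Nat.strong_induction_on generalizing j with
  | _ n ih =>
    obtain ⟨j, rfl⟩ : ∃ i, j = i + 1 := ⟨j - 1, by omega⟩
    match n with
    | 0 => simp [assocStirling]
    | 1 => simp [assocStirling]
    | n + 2 =>
      simp [add_two_succ, ih (n + 1) (by omega) (j := j + 1) (by omega),
        ih n (by omega) (j := j) (by omega)]

theorem pos {n j : ℕ} (hj : 1 ≤ j) (h : 2 * j ≤ n) : 0 < assocStirling n j := by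
  induction n using Nat.strong_induction_on generalizing j with
  | _ n ih =>
    obtain ⟨j, rfl⟩ : ∃ i, j = i + 1 := ⟨j - 1, by omega⟩
    obtain ⟨n, rfl⟩ : ∃ i, n = i + 2 := ⟨n - 2, by omega⟩
    rw [add_two_succ]
    rcases Nat.eq_zero_or_pos j with rfl | hj
    · rcases Nat.eq_zero_or_pos n with rfl | hn
      · simp [assocStirling]
      · have := ih (n + 1) (by omega) (le_refl 1) (by omega)
        simp only [zero_add]
        omega
    · have := ih n (by omega) hj (by omega)
      positivity

/-- Decomposition according to the block that contains a fixed element. -/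
theorem succ_succ_eq_sum (n j : ℕ) : assocStirling (n + 1) (j + 1) =
    ∑ m ∈ range n, n.choose m * assocStirling m j := by
  induction n using Nat.strong_induction_on generalizing j with
  | _ n ih =>
  match n with
  | 0 => simp [one_left]
  | n + 1 =>
    have shifted : ∑ m ∈ range n, n.choose m * assocStirling (m + 1) j =
        j * assocStirling (n + 1) (j + 1) + n * assocStirling n j := by
      match n, j with
      | 0, j => simp [one_left]
      | n + 1, 0 => simp [succ_zero]
      | n + 1, j + 1 =>
        have hsplit := ih (n + 1) (by omega) (j + 1)
        rw [sum_range_succ'] at hsplit ⊢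
        rw [hsplit, ih n (by omega) j, one_left, mul_sum, mul_add, mul_sum]
        simp only [assocStirling, mul_zero, add_zero]
        rw [← sum_add_distrib]
        refine sum_congr rfl fun m _ => ?_
        linear_combination assocStirling m j * (Nat.add_one_mul_choose_eq n m).symm
    have hsame := ih n (by omega) j
    have hadd : ∑ m ∈ range (n + 1), n.choose m * assocStirling m j =
        assocStirling (n + 1) (j + 1) + assocStirling n j := by
      rw [sum_range_succ, hsame, Nat.choose_self, one_mul]
    rw [sum_range_succ'] at hadd ⊢
    simp only [Nat.choose_succ_succ' n, add_mul, sum_add_distrib, shifted, add_two_succ]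
    simp only [Nat.choose_zero_right] at hadd ⊢
    linarith

end assocStirling

/-- Chaining of ratio inequalities `a₁ / a₀ ≤ b₁ / b₀`, in cross-multiplied form. -/
theorem Nat.cross_mul_le_trans {a₀ a₁ b₀ b₁ c₀ c₁ : ℕ} (hb₀ : 0 < b₀) (hb₁ : 0 < b₁)
    (hab : a₁ * b₀ ≤ a₀ * b₁) (hbc : b₁ * c₀ ≤ b₀ * c₁) : a₁ * c₀ ≤ a₀ * c₁ := by
  refine Nat.le_of_mul_le_mul_right ?_ (Nat.mul_pos hb₀ hb₁)
  calc a₁ * c₀ * (b₀ * b₁) = (a₁ * b₀) * (b₁ * c₀) := by ring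
    _ ≤ (a₀ * b₁) * (b₀ * c₁) := Nat.mul_le_mul hab hbc
    _ = a₀ * c₁ * (b₀ * b₁) := by ring

namespace assocStirling

theorem diagonal_of_mul_succ_le {n : ℕ}
    (h : ∀ m ≤ n, ∀ j, assocStirling n j * assocStirling m (j + 1) ≤
      assocStirling m j * assocStirling n (j + 1)) (j : ℕ) :
    assocStirling (n + 1) (j + 2) * assocStirling n j ≤
      assocStirling (n + 1) (j + 1) * assocStirling n (j + 1) := by
  rw [succ_succ_eq_sum n (j + 1), succ_succ_eq_sum n j, sum_mul, sum_mul]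
  refine sum_le_sum fun l hl => ?_
  have := Nat.mul_le_mul_left (n.choose l) (h l (mem_range.1 hl).le j)
  linarith

/-- The ratios `assocStirling n j / assocStirling m j`, `m ≤ n`, are nondecreasing in `j`. -/
theorem mul_succ_le_of_le {m n : ℕ} (hmn : m ≤ n) (j : ℕ) :
    assocStirling n j * assocStirling m (j + 1) ≤
      assocStirling m j * assocStirling n (j + 1) := by
  induction n using Nat.strong_induction_on generalizing m j with
  | _ n ih =>
  rcases hmn.eq_or_lt with rfl | hmn
  · rfl
  match n with
  | 0 => omega
  | 1 => simp [one_left]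
  | n + 2 =>
    rcases Nat.eq_zero_or_pos j with rfl | hj
    · simp [succ_zero]
    have adjacent : assocStirling (n + 2) j * assocStirling (n + 1) (j + 1) ≤
        assocStirling (n + 1) j * assocStirling (n + 2) (j + 1) := by
      obtain ⟨j, rfl⟩ : ∃ i, j = i + 1 := ⟨j - 1, by omega⟩
      have hdiag := diagonal_of_mul_succ_le
        (fun l hl i => ih n (by omega) hl i) j
      rw [add_two_succ, add_two_succ]
      have := Nat.mul_le_mul_left (n + 1) hdiag
      nlinarith [Nat.zero_le (assocStirling (n + 1) (j + 1) * assocStirling (n + 1) (j + 2))]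
    by_cases hm : m < 2 * (j + 1)
    · simp [eq_zero_of_lt hm]
    have chain := ih (n + 1) (by omega) (show m ≤ n + 1 by omega) j
    rw [mul_comm] at adjacent ⊢
    exact Nat.cross_mul_le_trans (pos (n := n + 1) (j := j) hj (by omega))
      (pos (n := n + 1) (j := j + 1) (by omega) (by omega)) (by linarith) adjacent

theorem diagonal_succ_le (d m q : ℕ) (hq : 1 ≤ q) (h : 2 * (q + d + 1) ≤ m + d) :
    assocStirling (m + d) (q + d + 1) * assocStirling m q ≤
      assocStirling (m + d) (q + d) * assocStirling m (q + 1) := by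
  induction d with
  | zero => exact (mul_comm _ _).le
  | succ d ih =>
    exact Nat.cross_mul_le_trans (pos (n := m + d) (j := q + d) (by omega) (by omega))
      (pos (n := m + d) (j := q + d + 1) (by omega) (by omega))
      (diagonal_of_mul_succ_le (fun l hl i => mul_succ_le_of_le hl i) (q + d)) (ih (by omega))

/-- Log-supermodularity of `assocStirling` along the diagonal direction. -/
theorem diagonal_mul_le (m q d c : ℕ) :
    assocStirling (m + d) (q + d + c) * assocStirling m q ≤
      assocStirling (m + d) (q + d) * assocStirling m (q + c) := by
  by_cases h : m + d < 2 * (q + d + c)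
  · rcases Nat.eq_zero_or_pos c with rfl | hc
    · rfl
    · simp [eq_zero_of_lt h]
  rcases Nat.eq_zero_or_pos q with rfl | hq
  · rcases m with _ | m
    · obtain ⟨rfl, rfl⟩ : d = 0 ∧ c = 0 := by omega
      rfl
    · simp [succ_zero]
  induction c with
  | zero => rfl
  | succ c ih =>
    have hnext := diagonal_succ_le d m (q + c) (by omega) (by omega)
    rw [show q + c + d + 1 = q + d + (c + 1) by ring, show q + c + d = q + d + c by ring] at hnext
    rw [mul_comm (assocStirling (m + d) (q + d))]
    exact Nat.cross_mul_le_trans (pos (n := m) (j := q + c) (by omega) (by omega))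
      (pos (n := m + d) (j := q + d + c) (by omega) (by omega))
      (hnext.trans (mul_comm _ _).le) ((ih (by omega)).trans (mul_comm _ _).le)

end assocStirling

/-- The number of partitions of an `n`-element set into `i` blocks of which exactly `s` are
singletons. -/
def partitionCount (n s i : ℕ) : ℕ :=
  if s ≤ i then n.choose s * assocStirling (n - s) (i - s) else 0

theorem partitionCount_mul_le (n s i t l : ℕ) : partitionCount n s i * partitionCount n t l ≤
    partitionCount n (min s t) (min i l) * partitionCount n (max s t) (max i l) := by
  wlog hst : t ≤ s generalizing s t i l
  · rw [mul_comm, min_comm s, max_comm s, min_comm i, max_comm i]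
    exact this t l s i (by omega)
  rw [min_eq_right hst, max_eq_left hst]
  rcases le_total l i with hli | hli
  · rw [min_eq_right hli, max_eq_left hli, mul_comm]
  rw [min_eq_left hli, max_eq_right hli]
  by_cases hsi : s ≤ i
  · by_cases hsn : s ≤ n
    · obtain ⟨d, rfl⟩ := Nat.exists_eq_add_of_le hst
      obtain ⟨q, rfl⟩ := Nat.exists_eq_add_of_le hsi
      obtain ⟨c, rfl⟩ := Nat.exists_eq_add_of_le hli
      obtain ⟨m, rfl⟩ := Nat.exists_eq_add_of_le hsn
      have := Nat.mul_le_mul_left ((t + d + m).choose (t + d) * (t + d + m).choose t)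
        (assocStirling.diagonal_mul_le m q d c)
      simp only [partitionCount]
      rw [if_pos (by omega), if_pos (by omega), if_pos (by omega), if_pos (by omega),
        show t + d + m - (t + d) = m by omega, show t + d + m - t = m + d by omega,
        show t + d + q - (t + d) = q by omega, show t + d + q + c - t = q + d + c by omega,
        show t + d + q - t = q + d by omega, show t + d + q + c - (t + d) = q + c by omega]
      linarith
    · simp [partitionCount, Nat.choose_eq_zero_of_lt (not_le.1 hsn)]
  · simp [partitionCount, hsi]

theorem descFactorial_mul_le (k : ℕ) {i l : ℕ} (h : l ≤ i) :
    k.descFactorial i * (k + 1).descFactorial l ≤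
      k.descFactorial l * (k + 1).descFactorial i := by
  induction i, h using Nat.le_induction with
  | base => rfl
  | succ i _ ih =>
    rw [Nat.descFactorial_succ, Nat.descFactorial_succ]
    calc _ = (k - i) * (k.descFactorial i * (k + 1).descFactorial l) := by ring
      _ ≤ (k + 1 - i) * (k.descFactorial l * (k + 1).descFactorial i) :=
        Nat.mul_le_mul (by omega) ih
      _ = _ := by ring

/-- The number of functions from an `n`-element set to a `k`-element set with exactly `u.1`
fibres of size one and `u.2` nonempty fibres. -/
def occupancyCount (n k : ℕ) (u : ℕ × ℕ) : ℕ :=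
  k.descFactorial u.2 * partitionCount n u.1 u.2

theorem occupancyCount_mul_le (n k : ℕ) (u v : ℕ × ℕ) :
    occupancyCount n k u * occupancyCount n (k + 1) v ≤
      occupancyCount n k (u ⊓ v) * occupancyCount n (k + 1) (u ⊔ v) := by
  have hdesc : k.descFactorial u.2 * (k + 1).descFactorial v.2 ≤
      k.descFactorial (min u.2 v.2) * (k + 1).descFactorial (max u.2 v.2) := by
    rcases le_total u.2 v.2 with h | h
    · rw [min_eq_left h, max_eq_right h]
    · rw [min_eq_right h, max_eq_left h]
      exact descFactorial_mul_le k h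
  have := Nat.mul_le_mul hdesc (partitionCount_mul_le n u.1 u.2 v.1 v.2)
  simp only [occupancyCount, Prod.fst_inf, Prod.snd_inf, Prod.fst_sup, Prod.snd_sup]
  linarith

theorem sum_occupancyCount_mul_le (n k r : ℕ) :
    let I := range (n + 1) ×ˢ range (n + 1)
    (∑ u ∈ I with r ≤ u.1, occupancyCount n k u) * ∑ u ∈ I, occupancyCount n (k + 1) u ≤
      (∑ u ∈ I, occupancyCount n k u) * ∑ u ∈ I with r ≤ u.1, occupancyCount n (k + 1) u := by
  intro I
  have h := four_functions_theorem (β := ℕ) (fun u => if r ≤ u.1 then occupancyCount n k u else 0)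
    (occupancyCount n (k + 1)) (occupancyCount n k)
    (fun u => if r ≤ u.1 then occupancyCount n (k + 1) u else 0)
    (fun _ => Nat.zero_le _) (fun _ => Nat.zero_le _) (fun _ => Nat.zero_le _)
    (fun _ => Nat.zero_le _) (fun u v => ?_) I I
  · rw [sum_filter, sum_filter]
    refine h.trans (Nat.mul_le_mul (sum_le_sum_of_subset ?_) (sum_le_sum_of_subset ?_))
    · rw [infs_subset_iff]
      intro a ha b hb
      simp only [I, mem_product, mem_range, Prod.fst_inf, Prod.snd_inf] at *
      omega
    · rw [sups_subset_iff]
      intro a ha b hb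
      simp only [I, mem_product, mem_range, Prod.fst_sup, Prod.snd_sup] at *
      omega
  · by_cases hu : r ≤ u.1
    · simpa [hu] using occupancyCount_mul_le n k u v
    · simp [hu]
theorem choose_mul_assocStirling_succ (n s j : ℕ) :
    n.choose s * assocStirling (n + 1 - s) (j + 1) =
      (s + 1) * (n.choose (s + 1) * assocStirling (n - (s + 1)) j) +
        (j + 1) * (n.choose s * assocStirling (n - s) (j + 1)) := by
  rcases lt_trichotomy n s with h | rfl | h
  · simp [Nat.choose_eq_zero_of_lt h, Nat.choose_eq_zero_of_lt (h.trans s.lt_succ_self)]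
  · simp [assocStirling]
  · obtain ⟨m, rfl⟩ := Nat.exists_eq_add_of_lt h
    have hchoose := Nat.choose_succ_right_eq (s + m + 1) s
    rw [show s + m + 1 - s = m + 1 by omega] at hchoose
    rw [show s + m + 1 + 1 - s = m + 2 by omega, show s + m + 1 - s = m + 1 by omega,
      show s + m + 1 - (s + 1) = m by omega, assocStirling.add_two_succ]
    linear_combination assocStirling m j * hchoose.symm

theorem choose_mul_assocStirling_zero (n s : ℕ) :
    n.choose s * assocStirling (n + 1 - s) 0 = 0 := by
  rcases le_or_gt s n with h | h
  · rw [show n + 1 - s = n - s + 1 by omega, assocStirling.succ_zero, mul_zero]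
  · rw [Nat.choose_eq_zero_of_lt h, zero_mul]

section Occupancy

variable {n k : ℕ}

/-- The size of the fibre of `x` over `b`. -/
def load (x : Fin n → Fin k) (b : Fin k) : ℕ := #{p | x p = b}

/-- The number of fibres of size exactly one. -/
def singles (x : Fin n → Fin k) : ℕ := #{b | load x b = 1}

/-- The number of fibres of size at least two. -/
def multiples (x : Fin n → Fin k) : ℕ := #{b | 2 ≤ load x b}

theorem load_cons (a : Fin k) (x : Fin n → Fin k) (b : Fin k) :
    load (Fin.cons a x : Fin (n + 1) → Fin k) b = load x b + if a = b then 1 else 0 := by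
  simp only [load, card_filter, Fin.sum_univ_succ, Fin.cons_zero, Fin.cons_succ]
  exact add_comm _ _

theorem card_load_eq_zero_add (x : Fin n → Fin k) :
    #{b | load x b = 0} + singles x + multiples x = k := by
  simp only [singles, multiples, card_filter, ← sum_add_distrib]
  rw [sum_congr rfl (g := fun _ => 1) fun b _ => by split_ifs <;> omega]
  simp

theorem singles_add_multiples_le (x : Fin n → Fin k) : singles x + multiples x ≤ n := by
  have hdisj : Disjoint (univ.filter fun b => load x b = 1) (univ.filter fun b => 2 ≤ load x b) :=
    disjoint_filter.2 fun b _ h => by omega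
  calc singles x + multiples x =
        #((univ.filter fun b => load x b = 1) ∪ univ.filter fun b => 2 ≤ load x b) :=
        (card_union_of_disjoint hdisj).symm
    _ ≤ #(univ.image x) := card_le_card fun b hb => by
        have : 0 < load x b := by
          simp only [mem_union, mem_filter_univ] at hb
          omega
        obtain ⟨p, hp⟩ := card_pos.1 this
        exact mem_image.2 ⟨p, mem_univ p, (mem_filter.1 hp).2⟩
    _ ≤ n := card_image_le.trans (by simp)

theorem singles_cons_of_zero {x : Fin n → Fin k} {a : Fin k} (h : load x a = 0) :
    singles (Fin.cons a x : Fin (n + 1) → Fin k) = singles x + 1 ∧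
      multiples (Fin.cons a x : Fin (n + 1) → Fin k) = multiples x := by
  constructor
  · rw [singles, singles, ← card_insert_of_notMem (a := a) (by simp [h])]
    congr 1
    ext b
    by_cases hab : a = b
    · subst hab; simp [load_cons, h]
    · simp [load_cons, hab, Ne.symm hab]
  · rw [multiples, multiples]
    congr 1
    ext b
    by_cases hab : a = b
    · subst hab; simp [load_cons, h]
    · simp [load_cons, hab]

theorem singles_cons_of_one {x : Fin n → Fin k} {a : Fin k} (h : load x a = 1) :
    singles (Fin.cons a x : Fin (n + 1) → Fin k) = singles x - 1 ∧
      multiples (Fin.cons a x : Fin (n + 1) → Fin k) = multiples x + 1 := by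
  constructor
  · rw [singles, singles, ← card_erase_of_mem (a := a) (by simp [h])]
    congr 1
    ext b
    by_cases hab : a = b
    · subst hab; simp [load_cons, h]
    · simp [load_cons, hab, Ne.symm hab]
  · rw [multiples, multiples, ← card_insert_of_notMem (a := a) (by simp [h])]
    congr 1
    ext b
    by_cases hab : a = b
    · subst hab; simp [load_cons, h]
    · simp [load_cons, hab, Ne.symm hab]

theorem singles_cons_of_two_le {x : Fin n → Fin k} {a : Fin k} (h : 2 ≤ load x a) :
    singles (Fin.cons a x : Fin (n + 1) → Fin k) = singles x ∧
      multiples (Fin.cons a x : Fin (n + 1) → Fin k) = multiples x := by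
  constructor
  · rw [singles, singles]
    congr 1
    ext b
    by_cases hab : a = b
    · subst hab; simp [load_cons]; omega
    · simp [load_cons, hab]
  · rw [multiples, multiples]
    congr 1
    ext b
    by_cases hab : a = b
    · subst hab; simp [load_cons]; omega
    · simp [load_cons, hab]

theorem sum_cons (F : ℕ → ℕ → ℕ) (x : Fin n → Fin k) :
    ∑ a, F (singles (Fin.cons a x : Fin (n + 1) → Fin k))
        (multiples (Fin.cons a x : Fin (n + 1) → Fin k)) =
      (k - (singles x + multiples x)) * F (singles x + 1) (multiples x) +
        singles x * F (singles x - 1) (multiples x + 1) +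
        multiples x * F (singles x) (multiples x) := by
  have hpoint (a : Fin k) : F (singles (Fin.cons a x : Fin (n + 1) → Fin k))
      (multiples (Fin.cons a x : Fin (n + 1) → Fin k)) =
      (if load x a = 0 then 1 else 0) * F (singles x + 1) (multiples x) +
        (if load x a = 1 then 1 else 0) * F (singles x - 1) (multiples x + 1) +
        (if 2 ≤ load x a then 1 else 0) * F (singles x) (multiples x) := by
    rcases (by omega : load x a = 0 ∨ load x a = 1 ∨ 2 ≤ load x a) with h | h | h
    · simp [singles_cons_of_zero h, h]
    · simp [singles_cons_of_one h, h]
    · simp [singles_cons_of_two_le h, h, show load x a ≠ 0 by omega, show load x a ≠ 1 by omega]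
  have hk := card_load_eq_zero_add x
  simp only [hpoint, sum_add_distrib, ← sum_mul, ← card_filter]
  rw [show #{b | load x b = 0} = k - (singles x + multiples x) by omega]
  rfl

theorem card_singles_multiples (n k s j : ℕ) :
    #{x : Fin n → Fin k | singles x = s ∧ multiples x = j} =
      k.descFactorial (s + j) * (n.choose s * assocStirling (n - s) j) := by
  induction n generalizing s j with
  | zero =>
    have hzero (x : Fin 0 → Fin k) : singles x = 0 ∧ multiples x = 0 := by
      have := singles_add_multiples_le x
      omega
    rcases s with _ | s
    · rcases j with _ | j
      · simp [hzero, assocStirling]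
      · simp [hzero, assocStirling]
    · simp [hzero]
  | succ n ih =>
    have hstep : #{x : Fin (n + 1) → Fin k | singles x = s ∧ multiples x = j} =
        (∑ x : Fin n → Fin k, if singles x + 1 = s ∧ multiples x = j then
          k - (singles x + multiples x) else 0) +
        (∑ x : Fin n → Fin k, if singles x = s + 1 ∧ multiples x + 1 = j then s + 1 else 0) +
        ∑ x : Fin n → Fin k, if singles x = s ∧ multiples x = j then j else 0 := by
      rw [card_filter, ← (Fin.consEquiv fun _ => Fin k).sum_comp, Fintype.sum_prod_type_right,
        ← sum_add_distrib, ← sum_add_distrib]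
      refine sum_congr rfl fun x _ => ?_
      refine (sum_cons (fun s' j' => if s' = s ∧ j' = j then 1 else 0) x).trans ?_
      simp only [mul_ite, mul_one, mul_zero]
      congr 1
      · congr 1
        by_cases h0 : singles x = 0
        · simp [h0]
        · split_ifs <;> omega
      · split_ifs <;> omega
    have hfirst : (∑ x : Fin n → Fin k, if singles x + 1 = s ∧ multiples x = j then
        k - (singles x + multiples x) else 0) = k.descFactorial (s + j) *
          if s = 0 then 0 else n.choose (s - 1) * assocStirling (n + 1 - s) j := by
      rcases s with _ | s
      · simp
      · rw [sum_congr rfl (g := fun x => if singles x = s ∧ multiples x = j then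
          k - (s + j) else 0) fun x _ => by split_ifs <;> omega, ← sum_filter, sum_const, ih,
          show s + 1 + j = s + j + 1 by ring, Nat.descFactorial_succ]
        simp
        ring
    have hthird : (∑ x : Fin n → Fin k, if singles x = s ∧ multiples x = j then j else 0) =
        k.descFactorial (s + j) * (j * (n.choose s * assocStirling (n - s) j)) := by
      rw [← sum_filter, sum_const, ih, smul_eq_mul]
      ring
    have hchoose : (n + 1).choose s * assocStirling (n + 1 - s) j =
        (if s = 0 then 0 else n.choose (s - 1) * assocStirling (n + 1 - s) j) +
          n.choose s * assocStirling (n + 1 - s) j := by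
      rcases s with _ | s
      · simp
      · simp [Nat.choose_succ_succ', add_mul]
    rw [hstep, hfirst, hthird, hchoose]
    rcases j with _ | j
    · simp [choose_mul_assocStirling_zero]
    · rw [choose_mul_assocStirling_succ]
      simp only [add_left_inj]
      rw [← sum_filter, sum_const, ih, smul_eq_mul, show s + 1 + j = s + (j + 1) by ring]
      ring

theorem card_singles_occupied (n k : ℕ) (u : ℕ × ℕ) :
    #{x : Fin n → Fin k | (singles x, singles x + multiples x) = u} = occupancyCount n k u := by
  obtain ⟨s, i⟩ := u
  simp only [Prod.mk.injEq, occupancyCount, partitionCount]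
  split_ifs with h
  · obtain ⟨j, rfl⟩ := Nat.exists_eq_add_of_le h
    rw [Nat.add_sub_cancel_left, ← card_singles_multiples]
    congr 1
    ext x
    simp only [mem_filter_univ]
    omega
  · rw [mul_zero, card_eq_zero, filter_eq_empty_iff]
    intro x _
    omega

theorem card_le_singles (n k r : ℕ) : #{x : Fin n → Fin k | r ≤ singles x} =
    ∑ u ∈ range (n + 1) ×ˢ range (n + 1) with r ≤ u.1, occupancyCount n k u := by
  rw [card_eq_sum_card_fiberwise (f := fun x => (singles x, singles x + multiples x))
    (t := (range (n + 1) ×ˢ range (n + 1)).filter fun u => r ≤ u.1)]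
  · refine sum_congr rfl fun u hu => ?_
    rw [← card_singles_occupied, filter_filter]
    congr 1
    ext x
    simp only [mem_filter_univ, and_iff_right_iff_imp]
    rintro rfl
    exact (mem_filter.1 hu).2
  · intro x hx
    have := singles_add_multiples_le x
    simp only [coe_filter, mem_univ, true_and, Set.mem_ofPred_eq, mem_product, mem_range] at hx ⊢
    omega

theorem card_le_singles_mul_le (n k r : ℕ) :
    #{x : Fin n → Fin k | r ≤ singles x} * (k + 1) ^ n ≤
      k ^ n * #{x : Fin n → Fin (k + 1) | r ≤ singles x} := by
  have htotal (l : ℕ) : ∑ u ∈ range (n + 1) ×ˢ range (n + 1), occupancyCount n l u = l ^ n := by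
    have := card_le_singles n l 0
    simp only [Nat.zero_le, filter_true] at this
    rw [← this]
    simp
  have := sum_occupancyCount_mul_le n k r
  simpa only [htotal, ← card_le_singles] using this

end Occupancy

section Reassignment

variable {n k : ℕ}

/-- A permutation of the passengers taking those on the last bus to the initial segment of the
same size. -/
theorem exists_perm_lt_load_iff (x : Fin n → Fin (k + 1)) :
    ∃ σ : Equiv.Perm (Fin n), ∀ p, (σ p : ℕ) < load x (Fin.last k) ↔ x p = Fin.last k := by
  have hle : load x (Fin.last k) ≤ n := (card_filter_le _ _).trans (by simp)
  have hcard : Fintype.card {p // x p = Fin.last k} =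
      Fintype.card {j : Fin n // (j : ℕ) < load x (Fin.last k)} := by
    rw [Fintype.card_subtype, Fintype.card_subtype, Fin.card_filter_val_lt, min_eq_right hle, load]
  let e := Fintype.equivOfCardEq hcard
  refine ⟨e.extendSubtype, fun p => ⟨fun h => ?_, fun h => e.extendSubtype_mem p h⟩⟩
  by_contra hp
  exact e.extendSubtype_not_mem p hp h

/-- The destination of a passenger on bus `a` whose reassignment choice is `b`, together with the
remaining information on `(a, b)`. -/
def destinationEquiv (k : ℕ) : Fin (k + 1) × Fin k ≃ Fin k × Fin (k + 1) where
  toFun u := Fin.lastCases (motive := fun _ => Fin k × Fin (k + 1)) (u.2, Fin.last k)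
    (fun i => (i, u.2.castSucc)) u.1
  invFun v := Fin.lastCases (motive := fun _ => Fin (k + 1) × Fin k) (Fin.last k, v.1)
    (fun j => (v.1.castSucc, j)) v.2
  left_inv := by
    rintro ⟨a, b⟩
    refine Fin.lastCases ?_ (fun i => ?_) a <;> simp
  right_inv := by
    rintro ⟨a, b⟩
    refine Fin.lastCases ?_ (fun i => ?_) b <;> simp

theorem destinationEquiv_fst_eq_iff (u : Fin (k + 1) × Fin k) (i : Fin k) :
    (destinationEquiv k u).1 = i ↔ u.1 = i.castSucc ∨ u.1 = Fin.last k ∧ u.2 = i := by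
  obtain ⟨a, b⟩ := u
  refine Fin.lastCases ?_ (fun j => ?_) a
  · simp [destinationEquiv, (Fin.castSucc_ne_last i).symm]
  · simp [destinationEquiv]

/-- After reassignment the bus counts are those of a uniformly random assignment to `k` buses. -/
theorem exists_equiv_load_eq_Xcount' (n k : ℕ) :
    ∃ e : Config n k ≃ (Fin n → Fin k) × (Fin n → Fin (k + 1)),
      ∀ c, load (e c).1 = Xcount' n k c := by
  choose σ hσ using exists_perm_lt_load_iff (n := n) (k := k)
  refine ⟨(Equiv.prodShear (Equiv.refl _) fun x => Equiv.arrowCongr (σ x).symm (Equiv.refl _)).trans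
    ((Equiv.arrowProdEquivProdArrow _ _ _).symm.trans
      ((Equiv.arrowCongr (Equiv.refl _) (destinationEquiv k)).trans
        (Equiv.arrowProdEquivProdArrow _ _ _))), ?_⟩
  rintro ⟨x, y⟩
  ext i
  have hreassigned : #{p | x p = Fin.last k ∧ y (σ x p) = i} =
      #{j : Fin n | (j : ℕ) < load x (Fin.last k) ∧ y j = i} :=
    card_equiv (σ x) fun p => by simp [hσ]
  calc _ = #{p | x p = i.castSucc ∨ x p = Fin.last k ∧ y (σ x p) = i} := by
        refine congrArg card (filter_congr fun p _ => ?_)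
        exact destinationEquiv_fst_eq_iff (x p, y (σ x p)) i
    _ = load x i.castSucc + #{p | x p = Fin.last k ∧ y (σ x p) = i} := by
        rw [filter_or, card_union_of_disjoint, load]
        refine disjoint_filter.2 fun p _ h h' => (Fin.castSucc_ne_last i) (h.symm.trans h'.1)
    _ = Xcount' n k (x, y) i := by
        rw [hreassigned]
        rfl

end Reassignment

open Classical in
theorem card_eventAr (n k r : ℕ) : #{c | c ∈ eventAr n k r} =
    #{x : Fin n → Fin (k + 1) | r ≤ singles x} * k ^ n := by
  have : ({c | c ∈ eventAr n k r} : Finset (Config n k)) =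
      (univ.filter fun x : Fin n → Fin (k + 1) => r ≤ singles x) ×ˢ univ := by
    ext c
    simp only [mem_filter_univ, mem_product, mem_univ, and_true]
    rfl
  rw [this, card_product]
  simp

open Classical in
theorem card_eventAr' (n k r : ℕ) : #{c | c ∈ eventAr' n k r} =
    #{x : Fin n → Fin k | r ≤ singles x} * (k + 1) ^ n := by
  obtain ⟨e, he⟩ := exists_equiv_load_eq_Xcount' n k
  have : #{c | c ∈ eventAr' n k r} =
      #((univ.filter fun x : Fin n → Fin k => r ≤ singles x) ×ˢ
        (univ : Finset (Fin n → Fin (k + 1)))) :=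
    card_equiv e fun c => by
      simp only [mem_filter_univ, mem_product, mem_univ, and_true]
      rw [singles, he]
      rfl
  rw [this, card_product]
  simp

open Classical in
theorem card_eventAr'_le (n k r : ℕ) :
    #{c | c ∈ eventAr' n k r} ≤ #{c | c ∈ eventAr n k r} := by
  rw [card_eventAr, card_eventAr', mul_comm _ (k ^ n)]
  exact card_le_singles_mul_le n k r

open Classical in
theorem prob_le_prob {n k : ℕ} {E F : Set (Config n k)}
    (h : #{c | c ∈ E} ≤ #{c | c ∈ F}) : prob n k E ≤ prob n k F :=
  div_le_div_of_nonneg_right (Nat.cast_le.2 h) (Nat.cast_nonneg _)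

/-- For every `2 ≤ r ≤ n`, `P(A_r ∩ (A'_r)ᶜ) ≥ P(A'_r ∩ (A_r)ᶜ)`;
equivalently, `P(A_r) ≥ P(A'_r)`. -/
theorem prob_eventAr_ge (n k r : ℕ) (hn : 2 ≤ n) (hk : 1 ≤ k)
    (hr2 : 2 ≤ r) (hrn : r ≤ n) :
    prob n k (eventAr' n k r ∩ (eventAr n k r)ᶜ) ≤
        prob n k (eventAr n k r ∩ (eventAr' n k r)ᶜ) ∧
      prob n k (eventAr' n k r) ≤ prob n k (eventAr n k r) := by
  classical
  have hle := card_eventAr'_le n k r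
  refine ⟨prob_le_prob ?_, prob_le_prob hle⟩
  convert! card_sdiff_le_card_sdiff_iff.2 hle using 2 <;> ext c <;> simp
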